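/- arXiv:1802.03191 — 6 statements merged into one kernel-verified Lean document; each statement's English description precedes it below -/
import Mathlib

section
/- Suppose y = (y_S^j) is feasible for the LP relaxation of the set partitioning formulation MP, and define x_{ij}^k := Σ_{S ∋ (i,k)} y_S^j and ȳ_j := Σ_S y_S^j. Then there exists ŷ ∈ [0,1]^n with ŷ_j ≥ ȳ_j for every j ∈ I and Σ_{j∈I} ŷ_j = p such that (x, ŷ) is feasible for the LP relaxation of the formulation WOC; in particular x satisfies (1fb), (2fb), Σ_k x_{ij}^k ≤ ȳ_j for all i,j, Σ_{j∈I} ȳ_j ≤ p, and the weak order constraints. -/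
open Finset

namespace DOMP

/-- A valid column set: a nonempty set of (client, position) couples containing at most one
couple per client and at most one couple per position. -/
def IsCol (n : ℕ) (S : Finset (Fin n × Fin n)) : Prop :=
  S.Nonempty ∧ (∀ a ∈ S, ∀ b ∈ S, a.1 = b.1 → a = b) ∧
    (∀ a ∈ S, ∀ b ∈ S, a.2 = b.2 → a = b)

instance (n : ℕ) (S : Finset (Fin n × Fin n)) : Decidable (IsCol n S) :=
  @instDecidableAnd _ _ Finset.decidableNonempty
    (@instDecidableAnd _ _ (by infer_instance) (by infer_instance))

/-- Predecessor position (position `k - 1`). -/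
def fpred {n : ℕ} (k : Fin n) : Fin n :=
  ⟨k.val - 1, lt_of_le_of_lt (Nat.sub_le _ _) k.isLt⟩

/-- `x_{ij}^k := ∑_{S ∋ (i,k)} y_S^j` (sum over valid columns). -/
noncomputable def xval (n : ℕ) (y : Finset (Fin n × Fin n) → Fin n → ℝ)
    (i j k : Fin n) : ℝ :=
  ∑ S ∈ univ.filter (fun S : Finset (Fin n × Fin n) => IsCol n S ∧ (i, k) ∈ S), y S j

/-- `y` has entries in `[0,1]` on columns. -/
def YBounds (n : ℕ) (y : Finset (Fin n × Fin n) → Fin n → ℝ) : Prop :=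
  ∀ (S : Finset (Fin n × Fin n)) (j : Fin n), IsCol n S → 0 ≤ y S j ∧ y S j ≤ 1

/-- Constraint (1ma). -/
def C1ma (n : ℕ) (y : Finset (Fin n × Fin n) → Fin n → ℝ) : Prop :=
  ∀ i : Fin n, ∑ j : Fin n,
    ∑ S ∈ univ.filter (fun S : Finset (Fin n × Fin n) =>
      IsCol n S ∧ ∃ k : Fin n, (i, k) ∈ S), y S j = 1

/-- Constraint (2ma). -/
def C2ma (n : ℕ) (y : Finset (Fin n × Fin n) → Fin n → ℝ) : Prop :=
  ∀ k : Fin n, ∑ j : Fin n,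
    ∑ S ∈ univ.filter (fun S : Finset (Fin n × Fin n) =>
      IsCol n S ∧ ∃ i : Fin n, (i, k) ∈ S), y S j = 1

/-- Constraint (3ma). -/
def C3ma (n : ℕ) (y : Finset (Fin n × Fin n) → Fin n → ℝ) : Prop :=
  ∀ j : Fin n, ∑ S ∈ univ.filter (IsCol n), y S j ≤ 1

/-- Constraint (4ma). -/
def C4ma (n p : ℕ) (y : Finset (Fin n × Fin n) → Fin n → ℝ) : Prop :=
  ∑ j : Fin n, ∑ S ∈ univ.filter (IsCol n), y S j ≤ (p : ℝ)

/-- Constraint (5ma): weak order constraints in the `y` variables.  Positions are 0-based,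
so position `k` with `1 ≤ k.val` plays the role of `k = 2, …, n` and `fpred k` that of `k-1`. -/
def C5ma (n : ℕ) (r : Fin n × Fin n → Fin (n * n))
    (y : Finset (Fin n × Fin n) → Fin n → ℝ) : Prop :=
  ∀ k : Fin n, 1 ≤ k.val →
    ∑ i : Fin n, ∑ j : Fin n,
      ((∑ j' : Fin n, ∑ S ∈ univ.filter (fun S : Finset (Fin n × Fin n) =>
          IsCol n S ∧ ∃ i' : Fin n, (i', k) ∈ S ∧ r (i', j') ≤ r (i, j)), y S j') +
       (∑ j' : Fin n, ∑ S ∈ univ.filter (fun S : Finset (Fin n × Fin n) =>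
          IsCol n S ∧ ∃ i' : Fin n, (i', fpred k) ∈ S ∧ r (i, j) ≤ r (i', j')), y S j'))
      ≤ (n : ℝ) ^ 2

/-- Feasibility for the LP relaxation of the set partitioning formulation MP. -/
def MPfeas (n p : ℕ) (r : Fin n × Fin n → Fin (n * n))
    (y : Finset (Fin n × Fin n) → Fin n → ℝ) : Prop :=
  YBounds n y ∧ C1ma n y ∧ C2ma n y ∧ C3ma n y ∧ C4ma n p y ∧ C5ma n r y

/-- Constraint (1fb). -/
def C1fb (n : ℕ) (x : Fin n → Fin n → Fin n → ℝ) : Prop :=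
  ∀ i : Fin n, ∑ j : Fin n, ∑ k : Fin n, x i j k = 1

/-- Constraint (2fb). -/
def C2fb (n : ℕ) (x : Fin n → Fin n → Fin n → ℝ) : Prop :=
  ∀ k : Fin n, ∑ i : Fin n, ∑ j : Fin n, x i j k = 1

/-- Constraint (in1fb). -/
def Cin1fb (n : ℕ) (x : Fin n → Fin n → Fin n → ℝ) (yhat : Fin n → ℝ) : Prop :=
  ∀ i j : Fin n, ∑ k : Fin n, x i j k ≤ yhat j

/-- The weak order constraints in the `x` variables. -/
def WeakOrder (n : ℕ) (r : Fin n × Fin n → Fin (n * n))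
    (x : Fin n → Fin n → Fin n → ℝ) : Prop :=
  ∀ k : Fin n, 1 ≤ k.val →
    ∑ i : Fin n, ∑ j : Fin n,
      ((∑ q ∈ univ.filter (fun q : Fin n × Fin n => r q ≤ r (i, j)), x q.1 q.2 k) +
       (∑ q ∈ univ.filter (fun q : Fin n × Fin n => r (i, j) ≤ r q), x q.1 q.2 (fpred k)))
      ≤ (n : ℝ) ^ 2

/-- Feasibility for the LP relaxation of the formulation WOC. -/
def WOCfeas (n p : ℕ) (r : Fin n × Fin n → Fin (n * n))
    (x : Fin n → Fin n → Fin n → ℝ) (yhat : Fin n → ℝ) : Prop :=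
  (∀ i j k : Fin n, 0 ≤ x i j k ∧ x i j k ≤ 1) ∧
  (∀ j : Fin n, 0 ≤ yhat j ∧ yhat j ≤ 1) ∧
  C1fb n x ∧ C2fb n x ∧ Cin1fb n x yhat ∧
  (∑ j : Fin n, yhat j = (p : ℝ)) ∧ WeakOrder n r x

/-- Cost `c_S^j = ∑_{(i,k) ∈ S} λ^k c_{ij}` of a column. -/
noncomputable def colCost (n : ℕ) (c : Fin n → Fin n → ℝ) (lam : Fin n → ℝ)
    (S : Finset (Fin n × Fin n)) (j : Fin n) : ℝ :=
  ∑ q ∈ S, lam q.2 * c q.1 j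

/-- MP objective `∑_j ∑_S c_S^j y_S^j`. -/
noncomputable def objMP (n : ℕ) (c : Fin n → Fin n → ℝ) (lam : Fin n → ℝ)
    (y : Finset (Fin n × Fin n) → Fin n → ℝ) : ℝ :=
  ∑ j : Fin n, ∑ S ∈ univ.filter (IsCol n), colCost n c lam S j * y S j

/-- WOC objective `∑_i ∑_j ∑_k λ^k c_{ij} x_{ij}^k`. -/
noncomputable def objW (n : ℕ) (c : Fin n → Fin n → ℝ) (lam : Fin n → ℝ)
    (x : Fin n → Fin n → Fin n → ℝ) : ℝ :=
  ∑ i : Fin n, ∑ j : Fin n, ∑ k : Fin n, lam k * c i j * x i j k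

/-- The strong order constraints in the `y` variables. -/
def StrongOrderY (n : ℕ) (r : Fin n × Fin n → Fin (n * n))
    (y : Finset (Fin n × Fin n) → Fin n → ℝ) : Prop :=
  ∀ i j : Fin n, ∀ k : Fin n, 1 ≤ k.val →
    (∑ j' : Fin n, ∑ S ∈ univ.filter (fun S : Finset (Fin n × Fin n) =>
        IsCol n S ∧ ∃ i' : Fin n, (i', k) ∈ S ∧ r (i', j') ≤ r (i, j)), y S j') +
    (∑ j' : Fin n, ∑ S ∈ univ.filter (fun S : Finset (Fin n × Fin n) =>
        IsCol n S ∧ ∃ i' : Fin n, (i', fpred k) ∈ S ∧ r (i, j) ≤ r (i', j')), y S j') ≤ 1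

/-- The strong order constraints in the `x` variables. -/
def StrongOrderX (n : ℕ) (r : Fin n × Fin n → Fin (n * n))
    (x : Fin n → Fin n → Fin n → ℝ) : Prop :=
  ∀ i j : Fin n, ∀ k : Fin n, 1 ≤ k.val →
    (∑ q ∈ univ.filter (fun q : Fin n × Fin n => r q ≤ r (i, j)), x q.1 q.2 k) +
    (∑ q ∈ univ.filter (fun q : Fin n × Fin n => r (i, j) ≤ r q), x q.1 q.2 (fpred k)) ≤ 1

/-- Coefficient `d_{ij}^k` of the pricing subproblem.  Positions are 0-based, so position
`k : Fin n` corresponds to the 1-based position `k.val + 1`; the dual multipliers `ε` are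
indexed 1-based (with the conventions `ε 1 = 0` and `ε (n+1) = 0`). -/
noncomputable def dCoef (n : ℕ) (c : Fin n → Fin n → ℝ) (lam : Fin n → ℝ)
    (r : Fin n × Fin n → Fin (n * n)) (α β : Fin n → ℝ) (ε : ℕ → ℝ)
    (i j k : Fin n) : ℝ :=
  lam k * c i j
    + ((univ.filter (fun q : Fin n × Fin n => r (i, j) ≤ r q)).card : ℝ) * ε (k.val + 1)
    + ((univ.filter (fun q : Fin n × Fin n => r q ≤ r (i, j))).card : ℝ) * ε (k.val + 2)
    - α i - β k

/-- Reduced cost `c̄_S^j` of a column. -/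
noncomputable def redCost (n : ℕ) (c : Fin n → Fin n → ℝ) (lam : Fin n → ℝ)
    (r : Fin n × Fin n → Fin (n * n)) (α β γ : Fin n → ℝ) (δ : ℝ) (ε : ℕ → ℝ)
    (S : Finset (Fin n × Fin n)) (j : Fin n) : ℝ :=
  colCost n c lam S j + γ j + δ
    + ∑ k ∈ univ.filter (fun k : Fin n => 1 ≤ k.val), ∑ i' : Fin n, ∑ j' : Fin n,
        ((∑ q ∈ S.filter (fun q : Fin n × Fin n => q.2 = k ∧ r (q.1, j) ≤ r (i', j')),
            ε (k.val + 1)) +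
         (∑ q ∈ S.filter (fun q : Fin n × Fin n => q.2 = fpred k ∧ r (i', j') ≤ r (q.1, j)),
            ε (k.val + 1)))
    - ∑ q ∈ S, α q.1 - ∑ q ∈ S, β q.2

/-- Cut-modified coefficient `d_{ij}^k` (with dual multipliers `ζ` of the strong order cuts,
indexed 1-based in the position, with conventions `ζ i j 1 = 0` and `ζ i j (n+1) = 0`). -/
noncomputable def dCoefCut (n : ℕ) (c : Fin n → Fin n → ℝ) (lam : Fin n → ℝ)
    (r : Fin n × Fin n → Fin (n * n)) (α β : Fin n → ℝ) (ε : ℕ → ℝ)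
    (ζ : Fin n → Fin n → ℕ → ℝ) (i j k : Fin n) : ℝ :=
  lam k * c i j
    + (∑ q ∈ univ.filter (fun q : Fin n × Fin n => r (i, j) ≤ r q),
        (ε (k.val + 1) + ζ q.1 q.2 (k.val + 1)))
    + (∑ q ∈ univ.filter (fun q : Fin n × Fin n => r q ≤ r (i, j)),
        (ε (k.val + 2) + ζ q.1 q.2 (k.val + 2)))
    - α i - β k

/-- Cut-modified reduced cost `c̄_S^j`. -/
noncomputable def redCostCut (n : ℕ) (c : Fin n → Fin n → ℝ) (lam : Fin n → ℝ)
    (r : Fin n × Fin n → Fin (n * n)) (α β γ : Fin n → ℝ) (δ : ℝ) (ε : ℕ → ℝ)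
    (ζ : Fin n → Fin n → ℕ → ℝ)
    (S : Finset (Fin n × Fin n)) (j : Fin n) : ℝ :=
  colCost n c lam S j + γ j + δ
    + ∑ k ∈ univ.filter (fun k : Fin n => 1 ≤ k.val), ∑ i' : Fin n, ∑ j' : Fin n,
        ((∑ q ∈ S.filter (fun q : Fin n × Fin n => q.2 = k ∧ r (q.1, j) ≤ r (i', j')),
            (ε (k.val + 1) + ζ i' j' (k.val + 1))) +
         (∑ q ∈ S.filter (fun q : Fin n × Fin n => q.2 = fpred k ∧ r (i', j') ≤ r (q.1, j)),
            (ε (k.val + 1) + ζ i' j' (k.val + 1))))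
    - ∑ q ∈ S, α q.1 - ∑ q ∈ S, β q.2

/-- A staircase set: for any two distinct elements, first entries and second entries
compare the same way. -/
def Staircase (S : Finset (ℕ × ℕ)) : Prop :=
  ∀ u ∈ S, ∀ v ∈ S, u ≠ v → (u.1 < v.1 ↔ u.2 < v.2)

/-- The dynamic programming recursion (1-based indices `1, …, n`). -/
def DPrec (n : ℕ) (d g : ℕ → ℕ → ℝ) : Prop :=
  g 1 1 = min 0 (d 1 1) ∧
  (∀ k, 2 ≤ k → k ≤ n → g 1 k = min (d 1 k) (g 1 (k - 1))) ∧
  (∀ l, 2 ≤ l → l ≤ n → g l 1 = min (d l 1) (g (l - 1) 1)) ∧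
  (∀ l k, 2 ≤ l → l ≤ n → 2 ≤ k → k ≤ n →
    g l k = min (min (g (l - 1) (k - 1) + d l k) (g (l - 1) (k - 1)))
                (min (g l (k - 1)) (g (l - 1) k)))

/-- Dual objective `z_D(π)`. -/
noncomputable def zD (n p : ℕ) (α β γ : Fin n → ℝ) (δ : ℝ) (ε : ℕ → ℝ) : ℝ :=
  (∑ i : Fin n, α i) + (∑ k : Fin n, β k) - (∑ j : Fin n, γ j) - (p : ℝ) * δ
    - ∑ m ∈ Finset.Icc 2 n, (n : ℝ) ^ 2 * ε m

/-- A sum over the elements satisfying one of several mutually exclusive properties splits into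
the sums over the elements satisfying each property. -/
theorem sum_filter_and_exists {α ι M : Type*} [Fintype α] [Fintype ι] [AddCommMonoid M]
    (C : α → Prop) (Q : ι → α → Prop) [DecidablePred fun S => C S ∧ ∃ a, Q a S]
    [∀ a, DecidablePred fun S => C S ∧ Q a S]
    (huniq : ∀ S, C S → ∀ a b, Q a S → Q b S → a = b) (f : α → M) :
    ∑ S ∈ univ.filter (fun S => C S ∧ ∃ a, Q a S), f S =
      ∑ a, ∑ S ∈ univ.filter (fun S => C S ∧ Q a S), f S := by
  classical
  simp_rw [sum_filter]
  rw [sum_comm]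
  refine sum_congr rfl fun S _ => ?_
  split_ifs with h
  · obtain ⟨hC, a, ha⟩ := h
    rw [sum_eq_single a (fun b _ hb => if_neg fun hQ => hb (huniq S hC b a hQ.2 ha))
      (fun h => absurd (mem_univ a) h), if_pos ⟨hC, ha⟩]
  · exact (sum_eq_zero fun a _ => if_neg fun hQ => h ⟨hQ.1, a, hQ.2⟩).symm

section xval

variable {n : ℕ} (y : Finset (Fin n × Fin n) → Fin n → ℝ)

/-- Columns serving client `i` are split according to the position of `i`. -/
theorem sum_xval_position (i j : Fin n) :
    ∑ k, xval n y i j k =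
      ∑ S ∈ univ.filter (fun S : Finset (Fin n × Fin n) =>
        IsCol n S ∧ ∃ k : Fin n, (i, k) ∈ S), y S j :=
  (sum_filter_and_exists (IsCol n) (fun k S => (i, k) ∈ S)
    (fun _ hS _ _ ha hb => congrArg Prod.snd (hS.2.1 _ ha _ hb rfl)) fun S => y S j).symm

/-- Columns occupying position `k` are split according to the client in position `k`. -/
theorem sum_xval_filter (R : Fin n × Fin n → Prop) [DecidablePred R] (k : Fin n) :
    ∑ q ∈ univ.filter R, xval n y q.1 q.2 k =
      ∑ j, ∑ S ∈ univ.filter (fun S : Finset (Fin n × Fin n) =>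
        IsCol n S ∧ ∃ i : Fin n, (i, k) ∈ S ∧ R (i, j)), y S j := by
  rw [sum_filter, Fintype.sum_prod_type, sum_comm]
  refine sum_congr rfl fun j _ => ?_
  rw [sum_filter_and_exists (IsCol n) (fun i S => (i, k) ∈ S ∧ R (i, j))
    (fun _ hS _ _ ha hb => congrArg Prod.fst (hS.2.2 _ ha.1 _ hb.1 rfl))]
  refine sum_congr rfl fun i _ => ?_
  by_cases h : R (i, j) <;> simp [h, xval]

variable {y}

theorem xval_nonneg (hy : YBounds n y) (i j k : Fin n) : 0 ≤ xval n y i j k :=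
  sum_nonneg fun S hS => (hy S j (mem_filter.1 hS).2.1).1

theorem sum_xval_position_le (hy : YBounds n y) (i j : Fin n) :
    ∑ k, xval n y i j k ≤ ∑ S ∈ univ.filter (IsCol n), y S j := by
  rw [sum_xval_position]
  exact sum_le_sum_of_subset_of_nonneg (monotone_filter_right _ fun _ _ h => h.1)
    fun S hS _ => (hy S j (mem_filter.1 hS).2).1

theorem C1ma.c1fb_xval (h : C1ma n y) : C1fb n (xval n y) := fun i => by
  simpa only [sum_xval_position] using h i

theorem C2ma.c2fb_xval (h : C2ma n y) : C2fb n (xval n y) := fun k => by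
  have := sum_xval_filter y (fun _ => True) k
  simp only [filter_true, and_true, Fintype.sum_prod_type] at this
  exact this.trans (h k)

theorem C5ma.weakOrder_xval {r : Fin n × Fin n → Fin (n * n)} (h : C5ma n r y) :
    WeakOrder n r (xval n y) := fun k hk => by
  simpa only [sum_xval_filter] using h k hk

end xval

/-- A vector of the unit cube can be increased inside the cube to any prescribed larger
coordinate sum not exceeding the dimension. -/
theorem exists_le_sum_eq {ι : Type*} [Fintype ι] (u : ι → ℝ) (hu : ∀ j, u j ≤ 1)
    {p : ℝ} (hup : ∑ j, u j ≤ p) (hp : p ≤ Fintype.card ι) :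
    ∃ v : ι → ℝ, (∀ j, u j ≤ v j) ∧ (∀ j, v j ≤ 1) ∧ ∑ j, v j = p := by
  set U := ∑ j, u j with hU
  set t := (p - U) / (Fintype.card ι - U) with ht
  have ht0 : 0 ≤ t := div_nonneg (by linarith) (by linarith)
  have ht1 : t ≤ 1 := div_le_one_of_le₀ (by linarith) (by linarith)
  refine ⟨fun j => u j + t * (1 - u j), fun j => ?_, fun j => ?_, ?_⟩
  · nlinarith [hu j]
  · nlinarith [hu j]
  · have hsum : ∑ j, (u j + t * (1 - u j)) = U + t * (Fintype.card ι - U) := by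
      simp [sum_add_distrib, ← mul_sum, hU]
    rw [hsum]
    rcases eq_or_ne ((Fintype.card ι : ℝ) - U) 0 with h | h
    · rw [h]; linarith
    · rw [ht, div_mul_cancel₀ _ h]; ring

/-- If `y` is feasible for the LP relaxation of MP, then the induced
`x` together with a suitable `ŷ ≥ ȳ` summing to `p` is feasible for the LP relaxation of
WOC; in particular `x` satisfies (1fb), (2fb), the strengthened assignment constraints with
`ȳ`, `∑_j ȳ_j ≤ p`, and the weak order constraints. -/
theorem statement0 (n p : ℕ) (hn : 1 ≤ n) (hp1 : 1 ≤ p) (hpn : p ≤ n)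
    (c : Fin n → Fin n → ℝ) (lam : Fin n → ℝ) (hlam : ∀ k : Fin n, 0 ≤ lam k)
    (r : Fin n × Fin n → Fin (n * n)) (hr : Function.Bijective r)
    (hrc : ∀ a b : Fin n × Fin n, r a < r b → c a.1 a.2 ≤ c b.1 b.2)
    (y : Finset (Fin n × Fin n) → Fin n → ℝ)
    (hy : MPfeas n p r y) :
    ∃ yhat : Fin n → ℝ,
      (∀ j : Fin n, 0 ≤ yhat j ∧ yhat j ≤ 1) ∧
      (∀ j : Fin n, (∑ S ∈ univ.filter (IsCol n), y S j) ≤ yhat j) ∧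
      (∑ j : Fin n, yhat j = (p : ℝ)) ∧
      WOCfeas n p r (xval n y) yhat ∧
      C1fb n (xval n y) ∧ C2fb n (xval n y) ∧
      (∀ i j : Fin n, (∑ k : Fin n, xval n y i j k) ≤ ∑ S ∈ univ.filter (IsCol n), y S j) ∧
      ((∑ j : Fin n, ∑ S ∈ univ.filter (IsCol n), y S j) ≤ (p : ℝ)) ∧
      WeakOrder n r (xval n y) := by
  obtain ⟨hb, h1, h2, h3, h4, h5⟩ := hy
  obtain ⟨yhat, hle, hle1, hsum⟩ := exists_le_sum_eq
    (fun j => ∑ S ∈ univ.filter (IsCol n), y S j) h3 h4 (by simpa using hpn)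
  have hx := sum_xval_position_le hb
  have hbox : ∀ j, 0 ≤ yhat j ∧ yhat j ≤ 1 := fun j =>
    ⟨(sum_nonneg fun S hS => (hb S j (mem_filter.1 hS).2).1).trans (hle j), hle1 j⟩
  have hxbox : ∀ i j k, 0 ≤ xval n y i j k ∧ xval n y i j k ≤ 1 := fun i j k =>
    ⟨xval_nonneg hb i j k,
      (single_le_sum (fun k _ => xval_nonneg hb i j k) (mem_univ k)).trans
        ((hx i j).trans (h3 j))⟩
  exact ⟨yhat, hbox, hle, hsum,
    ⟨hxbox, hbox, h1.c1fb_xval, h2.c2fb_xval, fun i j => (hx i j).trans (hle j), hsum,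
      h5.weakOrder_xval⟩,
    h1.c1fb_xval, h2.c2fb_xval, hx, h4, h5.weakOrder_xval⟩

end DOMP
end

section
/- If y = (y_S^j) is feasible for the LP relaxation of MP and the induced values x_{ij}^k := Σ_{S ∋ (i,k)} y_S^j satisfy x_{ij}^k ∈ {0,1} for all i, j, k ∈ I, then y_S^j ∈ {0,1} for every column (S, j). -/
open Finset

namespace DOMP

/-- If every `x_{ij}^k` is binary and column `(S, j)` has positive weight, then a column `(T, j)`
missing some couple of `S` has zero weight. -/
theorem eq_zero_of_mem_of_notMem {n : ℕ} {y : Finset (Fin n × Fin n) → Fin n → ℝ}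
    (hb : YBounds n y) (h3 : C3ma n y)
    (hx : ∀ i j k : Fin n, xval n y i j k = 0 ∨ xval n y i j k = 1)
    {S T : Finset (Fin n × Fin n)} {j : Fin n} (hS : IsCol n S) (hT : IsCol n T)
    (hpos : 0 < y S j) {q : Fin n × Fin n} (hqS : q ∈ S) (hqT : q ∉ T) : y T j = 0 := by
  have hle : y S j ≤ xval n y q.1 j q.2 := by
    refine single_le_sum (f := fun U => y U j) (fun U hU => ?_) ?_
    · exact (hb U j (mem_filter.1 hU).2.1).1
    · exact mem_filter.2 ⟨mem_univ _, hS, hqS⟩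
  have hone : xval n y q.1 j q.2 = 1 := (hx _ _ _).resolve_left (by linarith)
  have hsum : y T j + xval n y q.1 j q.2 ≤ ∑ U ∈ univ.filter (IsCol n), y U j := by
    unfold xval
    rw [← sum_insert (f := fun U => y U j) (by simp [hqT])]
    refine sum_le_sum_of_subset_of_nonneg (fun U hU => ?_) (fun U hU _ => ?_)
    · rcases mem_insert.1 hU with rfl | hU
      · exact mem_filter.2 ⟨mem_univ _, hT⟩
      · exact mem_filter.2 ⟨mem_univ _, (mem_filter.1 hU).2.1⟩
    · exact (hb U j (mem_filter.1 hU).2).1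
  linarith [h3 j, (hb T j hT).1]

/-- If `y` is feasible for the LP relaxation of MP and the induced `x`
is binary, then `y` is binary. -/
theorem statement8 (n p : ℕ) (hn : 1 ≤ n) (hp1 : 1 ≤ p) (hpn : p ≤ n)
    (r : Fin n × Fin n → Fin (n * n)) (hr : Function.Bijective r)
    (y : Finset (Fin n × Fin n) → Fin n → ℝ)
    (hy : MPfeas n p r y)
    (hx : ∀ i j k : Fin n, xval n y i j k = 0 ∨ xval n y i j k = 1) :
    ∀ (S : Finset (Fin n × Fin n)) (j : Fin n), IsCol n S → y S j = 0 ∨ y S j = 1 := by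
  intro S j hS
  obtain ⟨hb, -, -, h3, -, -⟩ := hy
  rcases (hb S j hS).1.eq_or_lt with h0 | hpos
  · exact Or.inl h0.symm
  have huniq : ∀ T, IsCol n T → T ≠ S → y T j = 0 := by
    intro T hT hTS
    by_contra hne
    have hTpos : 0 < y T j := lt_of_le_of_ne (hb T j hT).1 (Ne.symm hne)
    apply hTS
    ext q
    constructor
    · intro hq
      by_contra hqS
      exact hpos.ne' (eq_zero_of_mem_of_notMem hb h3 hx hT hS hTpos hq hqS)
    · intro hq
      by_contra hqT
      exact hne (eq_zero_of_mem_of_notMem hb h3 hx hS hT hpos hq hqT)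
  obtain ⟨q, hq⟩ := hS.1
  have hxy : xval n y q.1 j q.2 = y S j := by
    refine sum_eq_single_of_mem S (mem_filter.2 ⟨mem_univ _, hS, hq⟩) (fun T hT hTS => ?_)
    exact huniq T (mem_filter.1 hT).2.1 hTS
  exact hxy ▸ hx q.1 j q.2

end DOMP
end

section
/- For every facility j ∈ I and every set S of couples (i,k) ∈ I × I (containing at most one couple per client and at most one couple per position), the reduced cost in the presence of the dual multipliers ζ of the strong order cuts decomposes as c̄_S^j = γ_j + δ + Σ_{(i,k)∈S} d_{ij}^k, where c̄_S^j and d_{ij}^k are the cut-modified reduced cost and coefficients. -/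
open Finset

namespace DOMP

/-- Summing over the positions `k ≥ 2` the terms attached to the couples of `S` at position `k`
gives a single sum over `S`, when the weight of the first position vanishes. -/
theorem sum_pos_eq {n : ℕ} (S : Finset (Fin n × Fin n)) (P : Fin n × Fin n → Prop)
    [DecidablePred P] (h : ℕ → ℝ) (h1 : h 1 = 0) :
    ∑ k ∈ univ.filter (fun k : Fin n => 1 ≤ k.val),
        ∑ q ∈ S.filter (fun q => q.2 = k ∧ P q), h (k.val + 1)
      = ∑ q ∈ S, if P q then h (q.2.val + 1) else 0 := by
  simp_rw [sum_filter (s := S)]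
  rw [sum_comm]
  refine sum_congr rfl fun q _ => ?_
  rw [sum_filter, sum_eq_single q.2]
  · by_cases hq : 1 ≤ q.2.val
    · simp [hq]
    · simp [show q.2.val = 0 by omega, h1]
  · intro k _ hk
    simp [hk.symm]
  · simp

/-- Summing over the positions `k ≥ 2` the terms attached to the couples of `S` at position `k - 1`
gives a single sum over `S`, when the weight following the last position vanishes. -/
theorem sum_fpred_eq {n : ℕ} (S : Finset (Fin n × Fin n)) (P : Fin n × Fin n → Prop)
    [DecidablePred P] (h : ℕ → ℝ) (htop : h (n + 1) = 0) :
    ∑ k ∈ univ.filter (fun k : Fin n => 1 ≤ k.val),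
        ∑ q ∈ S.filter (fun q => q.2 = fpred k ∧ P q), h (k.val + 1)
      = ∑ q ∈ S, if P q then h (q.2.val + 2) else 0 := by
  simp_rw [sum_filter (s := S)]
  rw [sum_comm]
  refine sum_congr rfl fun q _ => ?_
  rw [sum_filter]
  by_cases hq : q.2.val + 1 < n
  · rw [sum_eq_single ⟨q.2.val + 1, hq⟩]
    · simp [fpred]
    · intro k _ hk
      by_cases hk1 : 1 ≤ k.val
      · have : q.2 ≠ fpred k := fun e => hk (by
          have := congrArg Fin.val e
          simp only [fpred] at this
          ext
          simp only
          omega)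
        simp [this]
      · simp [hk1]
    · simp
  · have hn : q.2.val + 2 = n + 1 := by omega
    rw [hn, htop, ite_self]
    refine sum_eq_zero fun k _ => ?_
    by_cases hk1 : 1 ≤ k.val
    · have : q.2 ≠ fpred k := fun e => by
        have := congrArg Fin.val e
        simp only [fpred] at this
        omega
      simp [this]
    · simp [hk1]

/-- In the presence of the dual multipliers `ζ` of the strong order
cuts, the cut-modified reduced cost of any column decomposes as
`c̄_S^j = γ_j + δ + ∑_{(i,k) ∈ S} d_{ij}^k` with the cut-modified coefficients. -/
theorem statement12 (n p : ℕ) (hn : 1 ≤ n) (hp1 : 1 ≤ p) (hpn : p ≤ n)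
    (c : Fin n → Fin n → ℝ) (lam : Fin n → ℝ) (hlam : ∀ k : Fin n, 0 ≤ lam k)
    (r : Fin n × Fin n → Fin (n * n)) (hr : Function.Bijective r)
    (α β γ : Fin n → ℝ) (hγ : ∀ j : Fin n, 0 ≤ γ j) (δ : ℝ) (hδ : 0 ≤ δ)
    (ε : ℕ → ℝ) (hε : ∀ m : ℕ, 2 ≤ m → m ≤ n → 0 ≤ ε m)
    (hε1 : ε 1 = 0) (hεtop : ε (n + 1) = 0)
    (ζ : Fin n → Fin n → ℕ → ℝ)
    (hζ : ∀ (i j : Fin n) (m : ℕ), 2 ≤ m → m ≤ n → 0 ≤ ζ i j m)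
    (hζ1 : ∀ i j : Fin n, ζ i j 1 = 0) (hζtop : ∀ i j : Fin n, ζ i j (n + 1) = 0) :
    ∀ (j : Fin n) (S : Finset (Fin n × Fin n)),
      (∀ a ∈ S, ∀ b ∈ S, a.1 = b.1 → a = b) →
      (∀ a ∈ S, ∀ b ∈ S, a.2 = b.2 → a = b) →
      redCostCut n c lam r α β γ δ ε ζ S j
        = γ j + δ + ∑ q ∈ S, dCoefCut n c lam r α β ε ζ q.1 j q.2 := by
  intro j S _ _
  have key : ∑ k ∈ univ.filter (fun k : Fin n => 1 ≤ k.val), ∑ i' : Fin n, ∑ j' : Fin n,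
        ((∑ q ∈ S.filter (fun q : Fin n × Fin n => q.2 = k ∧ r (q.1, j) ≤ r (i', j')),
            (ε (k.val + 1) + ζ i' j' (k.val + 1))) +
         (∑ q ∈ S.filter (fun q : Fin n × Fin n => q.2 = fpred k ∧ r (i', j') ≤ r (q.1, j)),
            (ε (k.val + 1) + ζ i' j' (k.val + 1))))
      = ∑ q ∈ S, ((∑ u ∈ univ.filter (fun u : Fin n × Fin n => r (q.1, j) ≤ r u),
            (ε (q.2.val + 1) + ζ u.1 u.2 (q.2.val + 1)))
          + ∑ u ∈ univ.filter (fun u : Fin n × Fin n => r u ≤ r (q.1, j)),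
            (ε (q.2.val + 2) + ζ u.1 u.2 (q.2.val + 2))) := by
    simp_rw [← Fintype.sum_prod_type']
    rw [sum_comm]
    simp_rw [sum_filter (s := (univ : Finset (Fin n × Fin n))), ← sum_add_distrib]
    rw [sum_comm (s := S)]
    refine sum_congr rfl fun u _ => ?_
    rw [sum_add_distrib, sum_add_distrib,
      ← sum_pos_eq S (fun q => r (q.1, j) ≤ r u) (fun m => ε m + ζ u.1 u.2 m)
        (by simp [hε1, hζ1]),
      ← sum_fpred_eq S (fun q => r u ≤ r (q.1, j)) (fun m => ε m + ζ u.1 u.2 m)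
        (by simp [hεtop, hζtop])]
  rw [redCostCut, key]
  simp only [colCost, dCoefCut, sum_add_distrib, sum_sub_distrib]
  ring

end DOMP
end

section
/- For all l, k ∈ {1,…,n}, the value g(l,k) produced by the dynamic programming recursion equals the minimum, over all (possibly empty) staircase sets S ⊆ {1,…,l} × {1,…,k}, of Σ_{(a,b)∈S} d(a,b) (the empty sum being 0). In particular g(n,n) is the minimum of Σ_{(a,b)∈S} d(a,b) over all staircase subsets S of {1,…,n} × {1,…,n}. -/
open Finset

namespace DOMP

/-- Sums of `d` over the staircase subsets of `{1,…,l} × {1,…,k}`. -/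
def staircaseSums (d : ℕ → ℕ → ℝ) (l k : ℕ) : Set ℝ :=
  {v : ℝ | ∃ S : Finset (ℕ × ℕ),
    (∀ q ∈ S, 1 ≤ q.1 ∧ q.1 ≤ l ∧ 1 ≤ q.2 ∧ q.2 ≤ k) ∧ Staircase S ∧
    v = ∑ q ∈ S, d q.1 q.2}

theorem Staircase.mono {S T : Finset (ℕ × ℕ)} (hT : Staircase T) (h : S ⊆ T) : Staircase S :=
  fun u hu v hv => hT u (h hu) v (h hv)

theorem Staircase.insert_corner {S : Finset (ℕ × ℕ)} (hS : Staircase S) {a b : ℕ}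
    (h : ∀ q ∈ S, q.1 < a ∧ q.2 < b) : Staircase (insert (a, b) S) := by
  intro u hu v hv huv
  rw [Finset.mem_insert] at hu hv
  rcases hu with rfl | hu <;> rcases hv with rfl | hv
  · exact absurd rfl huv
  · have := h v hv
    simp only
    omega
  · have := h u hu
    simp only
    omega
  · exact hS u hu v hv huv

theorem staircaseSums_mono (d : ℕ → ℕ → ℝ) {l l' k k' : ℕ} (hl : l ≤ l') (hk : k ≤ k') :
    staircaseSums d l k ⊆ staircaseSums d l' k' := by
  rintro v ⟨S, hS, hst, hv⟩
  refine ⟨S, fun q hq => ?_, hst, hv⟩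
  have := hS q hq
  omega

theorem zero_mem_staircaseSums (d : ℕ → ℕ → ℝ) (l k : ℕ) : 0 ∈ staircaseSums d l k :=
  ⟨∅, by simp, by simp [Staircase], by simp⟩

theorem add_mem_staircaseSums {d : ℕ → ℕ → ℝ} {l k : ℕ} {v : ℝ}
    (h : v ∈ staircaseSums d l k) :
    v + d (l + 1) (k + 1) ∈ staircaseSums d (l + 1) (k + 1) := by
  obtain ⟨S, hS, hst, rfl⟩ := h
  have hlt : ∀ q ∈ S, q.1 < l + 1 ∧ q.2 < k + 1 := fun q hq => by
    have := hS q hq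
    omega
  refine ⟨insert (l + 1, k + 1) S, fun q hq => ?_, hst.insert_corner hlt, ?_⟩
  · rcases Finset.mem_insert.1 hq with rfl | hq
    · simp
    · have := hS q hq
      omega
  · rw [Finset.sum_insert fun hmem => (lt_irrefl _ (hlt _ hmem).1), add_comm]

theorem staircaseSums_eq_zero {d : ℕ → ℕ → ℝ} {l k : ℕ} (h : l = 0 ∨ k = 0) :
    staircaseSums d l k = {0} := by
  refine Set.Subset.antisymm ?_ (by simpa using zero_mem_staircaseSums d l k)
  rintro v ⟨S, hS, -, rfl⟩
  have hempty : S = ∅ := Finset.eq_empty_of_forall_notMem fun q hq => by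
    have := hS q hq
    omega
  simp [hempty]

theorem isLeast_staircaseSums_of_eq_zero {d : ℕ → ℕ → ℝ} {l k : ℕ} (h : l = 0 ∨ k = 0) :
    IsLeast (staircaseSums d l k) 0 := by
  rw [staircaseSums_eq_zero h]
  exact isLeast_singleton

/-- A staircase subset of `{1,…,l+1} × {1,…,k+1}` contains the corner `(l+1, k+1)`, or avoids
the last row, or avoids the last column. -/
theorem staircaseSums_succ_cases {d : ℕ → ℕ → ℝ} {l k : ℕ} {v : ℝ}
    (h : v ∈ staircaseSums d (l + 1) (k + 1)) :
    v - d (l + 1) (k + 1) ∈ staircaseSums d l k ∨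
      v ∈ staircaseSums d (l + 1) k ∨ v ∈ staircaseSums d l (k + 1) := by
  obtain ⟨S, hS, hst, rfl⟩ := h
  by_cases hc : (l + 1, k + 1) ∈ S
  · refine Or.inl ⟨S.erase (l + 1, k + 1), fun q hq => ?_, hst.mono (Finset.erase_subset _ _), ?_⟩
    · obtain ⟨hne, hq⟩ := Finset.mem_erase.1 hq
      have h1 := hS q hq
      have h2 := hst q hq _ hc hne
      have h3 := hst _ hc q hq hne.symm
      have h4 : ¬(q.1 = l + 1 ∧ q.2 = k + 1) := fun h => hne (Prod.ext h.1 h.2)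
      simp only at h2 h3
      omega
    · rw [← Finset.add_sum_erase S _ hc]
      simp
  · right
    by_cases hr : ∃ p ∈ S, p.1 = l + 1
    · obtain ⟨p, hp, hp1⟩ := hr
      refine Or.inl ⟨S, fun q hq => ?_, hst, rfl⟩
      have h1 := hS q hq
      have h2 := hS p hp
      have hpk : p.2 ≠ k + 1 := fun h => hc (by rwa [← hp1, ← h])
      have hqk : q.2 ≠ k + 1 := fun h => by
        have hpq := hst p hp q hq fun e => hpk (e ▸ h)
        omega
      omega
    · refine Or.inr ⟨S, fun q hq => ?_, hst, rfl⟩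
      have h1 := hS q hq
      have h2 : q.1 ≠ l + 1 := fun h => hr ⟨q, hq, h⟩
      omega

theorem isLeast_staircaseSums_succ {d : ℕ → ℕ → ℝ} {l k : ℕ} {a b c : ℝ}
    (ha : IsLeast (staircaseSums d l k) a) (hb : IsLeast (staircaseSums d (l + 1) k) b)
    (hc : IsLeast (staircaseSums d l (k + 1)) c) :
    IsLeast (staircaseSums d (l + 1) (k + 1))
      (min (min (a + d (l + 1) (k + 1)) a) (min b c)) := by
  constructor
  · have ha' := staircaseSums_mono d l.le_succ k.le_succ ha.1
    have hb' := staircaseSums_mono d le_rfl k.le_succ hb.1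
    have hc' := staircaseSums_mono d l.le_succ le_rfl hc.1
    have had := add_mem_staircaseSums ha.1
    rcases min_choice (min (a + d (l + 1) (k + 1)) a) (min b c) with h | h <;> rw [h]
    · rcases min_choice (a + d (l + 1) (k + 1)) a with h | h <;> rwa [h]
    · rcases min_choice b c with h | h <;> rwa [h]
  · intro v hv
    rcases staircaseSums_succ_cases hv with h | h | h
    · exact (min_le_left _ _).trans ((min_le_left _ _).trans (le_sub_iff_add_le.1 (ha.2 h)))
    · exact (min_le_right _ _).trans ((min_le_left _ _).trans (hb.2 h))
    · exact (min_le_right _ _).trans ((min_le_right _ _).trans (hc.2 h))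

/-- The recursion `DPrec` computes the staircase minima, with both indices shifted by one. -/
theorem DPrec.isLeast_staircaseSums {n : ℕ} {d g : ℕ → ℕ → ℝ} (hg : DPrec n d g) (l : ℕ) :
    ∀ k : ℕ, l + 1 ≤ n → k + 1 ≤ n →
      IsLeast (staircaseSums d (l + 1) (k + 1)) (g (l + 1) (k + 1)) := by
  obtain ⟨h11, h1k, hl1, hlk⟩ := hg
  induction l with
  | zero =>
    intro k hl hk
    induction k with
    | zero =>
      have h := isLeast_staircaseSums_succ
        (isLeast_staircaseSums_of_eq_zero (d := d) (l := 0) (k := 0) (by simp))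
        (isLeast_staircaseSums_of_eq_zero (by simp)) (isLeast_staircaseSums_of_eq_zero (by simp))
      convert h using 1
      simp [h11, min_comm]
    | succ k ih =>
      have hb := ih (by omega)
      have h0 := hb.2 (zero_mem_staircaseSums d _ _)
      have h := isLeast_staircaseSums_succ
        (isLeast_staircaseSums_of_eq_zero (by simp)) hb (isLeast_staircaseSums_of_eq_zero (by simp))
      convert h using 1
      have := h1k (k + 1 + 1) (by omega) hk
      simp only [Nat.zero_add, Nat.add_sub_cancel] at this h0 ⊢
      rw [this, min_eq_left h0, zero_add, min_assoc, min_eq_right h0]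
  | succ l ihl =>
    intro k hl hk
    induction k with
    | zero =>
      have hc := ihl 0 (by omega) hk
      have h0 := hc.2 (zero_mem_staircaseSums d _ _)
      have h := isLeast_staircaseSums_succ
        (isLeast_staircaseSums_of_eq_zero (by simp)) (isLeast_staircaseSums_of_eq_zero (by simp)) hc
      convert h using 1
      have := hl1 (l + 1 + 1) (by omega) hl
      simp only [Nat.zero_add, Nat.add_sub_cancel] at this h0 ⊢
      rw [this, min_eq_right h0, zero_add, min_assoc, min_eq_right h0]
    | succ k ihk =>
      have h := isLeast_staircaseSums_succ (ihl k (by omega) (by omega)) (ihk (by omega))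
        (ihl (k + 1) (by omega) hk)
      rwa [hlk (l + 1 + 1) (k + 1 + 1) (by omega) hl (by omega) hk]

/-- The dynamic programming recursion computes, for all `l, k`, the
minimum of `∑_{(a,b) ∈ S} d(a,b)` over all (possibly empty) staircase subsets `S` of
`{1,…,l} × {1,…,k}`; in particular `g n n` is this minimum for `{1,…,n} × {1,…,n}`. -/
theorem statement13 (n : ℕ) (hn : 1 ≤ n) (d g : ℕ → ℕ → ℝ) (hg : DPrec n d g) :
    ∀ l k : ℕ, 1 ≤ l → l ≤ n → 1 ≤ k → k ≤ n →
      IsLeast {v : ℝ | ∃ S : Finset (ℕ × ℕ),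
        (∀ q ∈ S, 1 ≤ q.1 ∧ q.1 ≤ l ∧ 1 ≤ q.2 ∧ q.2 ≤ k) ∧ Staircase S ∧
        v = ∑ q ∈ S, d q.1 q.2} (g l k) := by
  intro l k hl hln hk hkn
  obtain ⟨l, rfl⟩ := Nat.exists_eq_add_of_le' hl
  obtain ⟨k, rfl⟩ := Nat.exists_eq_add_of_le' hk
  exact hg.isLeast_staircaseSums l k hln hkn

end DOMP
end

section
/- Fix a facility j ∈ I and let i_1,…,i_n be the permutation of I with r_{i_1 j} < r_{i_2 j} < ⋯ < r_{i_n j}. Set d(l,k) := d_{i_l j}^k and let g be the function satisfying the dynamic programming recursion for this d. Then g(n,n) + δ + γ_j equals the minimum of c̄_S^j over all (possibly empty) sets S of couples (i,k) ∈ I × I such that S contains at most one couple with first entry i for each client i, at most one couple with second entry k for each position k, and whenever (i,k), (i',k') ∈ S with k < k' then r_{ij} < r_{i'j} (the reduced cost of the empty set being c̄_∅^j = γ_j + δ). -/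
open Finset

namespace DOMP

/-- A recursion with zero boundary, whose interior entries are minima over the three neighbours
and the diagonal step with gain `d`, computes the minimum weight of a staircase set in a box. -/
theorem isLeast_staircase_of_rec (n : ℕ) (d f : ℕ → ℕ → ℝ) (hl : ∀ k, f 0 k = 0)
    (hk : ∀ l, f l 0 = 0)
    (hrec : ∀ l k, l < n → k < n → f (l + 1) (k + 1) =
      min (min (f l k + d (l + 1) (k + 1)) (f l k)) (min (f (l + 1) k) (f l (k + 1))))
    (l k : ℕ) (hln : l ≤ n) (hkn : k ≤ n) :
    IsLeast {v : ℝ | ∃ T ⊆ Icc 1 l ×ˢ Icc 1 k, Staircase T ∧ v = ∑ q ∈ T, d q.1 q.2} (f l k) := by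
  induction l generalizing k with
  | zero =>
    refine ⟨⟨∅, by simp, by simp [Staircase], by simp [hl]⟩, ?_⟩
    rintro v ⟨T, hT, -, rfl⟩
    have : T = ∅ := by simpa using hT
    simp [this, hl]
  | succ l ihl =>
    induction k with
    | zero =>
      refine ⟨⟨∅, by simp, by simp [Staircase], by simp [hk]⟩, ?_⟩
      rintro v ⟨T, hT, -, rfl⟩
      have : T = ∅ := by simpa using hT
      simp [this, hk]
    | succ k ihk =>
      have A := ihl k (by omega) (by omega)
      have B := ihl (k + 1) (by omega) hkn
      have C := ihk (by omega)
      have mono : ∀ {a b : ℕ}, a ≤ l + 1 → b ≤ k + 1 →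
          (Icc 1 a ×ˢ Icc 1 b : Finset (ℕ × ℕ)) ⊆ Icc 1 (l + 1) ×ˢ Icc 1 (k + 1) :=
        fun ha hb => product_subset_product (Icc_subset_Icc_right ha) (Icc_subset_Icc_right hb)
      rw [hrec l k (by omega) (by omega)]
      constructor
      · obtain ⟨T, hT, hs, hv⟩ := A.1
        obtain ⟨T₂, hT₂, hs₂, hv₂⟩ := B.1
        obtain ⟨T₃, hT₃, hs₃, hv₃⟩ := C.1
        have lt : ∀ q ∈ T, q.1 < l + 1 ∧ q.2 < k + 1 := by
          intro q hq
          have := hT hq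
          simp only [mem_product, mem_Icc] at this
          omega
        have hmem : (l + 1, k + 1) ∉ T := fun h => by simpa using (lt _ h).1
        apply min_rec'
        · apply min_rec'
          · refine ⟨insert (l + 1, k + 1) T, ?_, ?_, ?_⟩
            · refine insert_subset (by simp) (hT.trans (mono (by omega) (by omega)))
            · intro u hu v hv huv
              rw [mem_insert] at hu hv
              rcases hu with rfl | hu <;> rcases hv with rfl | hv
              · exact absurd rfl huv
              · have := lt v hv
                constructor <;> intro h <;> simp only at h <;> omega
              · have := lt u hu
                simp [this]
              · exact hs u hu v hv huv
            · rw [sum_insert hmem, hv]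
              ring
          · exact ⟨T, hT.trans (mono (by omega) (by omega)), hs, hv⟩
        · apply min_rec'
          · exact ⟨T₃, hT₃.trans (mono le_rfl (by omega)), hs₃, hv₃⟩
          · exact ⟨T₂, hT₂.trans (mono (by omega) le_rfl), hs₂, hv₂⟩
      · rintro v ⟨T, hT, hs, rfl⟩
        have bd : ∀ q ∈ T, 1 ≤ q.1 ∧ q.1 ≤ l + 1 ∧ 1 ≤ q.2 ∧ q.2 ≤ k + 1 := by
          intro q hq
          have := hT hq
          simp only [mem_product, mem_Icc] at this
          omega
        by_cases hc : (l + 1, k + 1) ∈ T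
        · refine (min_le_left _ _).trans ((min_le_left _ _).trans ?_)
          rw [← sum_erase_add _ _ hc]
          refine add_le_add_left (A.2 ⟨T.erase (l + 1, k + 1), ?_, ?_, rfl⟩) _
          · intro q hq
            obtain ⟨hne, hq⟩ := mem_erase.1 hq
            have h := bd q hq
            have h1 := hs q hq _ hc hne
            have h2 := hs _ hc q hq hne.symm
            have h3 : ¬ (q.1 = l + 1 ∧ q.2 = k + 1) := fun h => hne (Prod.ext h.1 h.2)
            simp only [mem_product, mem_Icc] at h1 h2 ⊢
            omega
          · exact fun u hu v hv => hs u (mem_of_mem_erase hu) v (mem_of_mem_erase hv)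
        · by_cases hrow : ∃ b, (l + 1, b) ∈ T
          · obtain ⟨b, hb⟩ := hrow
            refine (min_le_right _ _).trans ((min_le_left _ _).trans (C.2 ⟨T, ?_, hs, rfl⟩))
            intro q hq
            have h := bd q hq
            have hbb := bd _ hb
            have hbne : b ≠ k + 1 := fun h => hc (h ▸ hb)
            by_cases hne : q = (l + 1, b)
            · subst hne
              simp only [mem_product, mem_Icc] at hbb ⊢
              omega
            · have h1 := hs _ hb q hq (Ne.symm hne)
              simp only [mem_product, mem_Icc] at h1 hbb ⊢
              omega
          · refine (min_le_right _ _).trans ((min_le_right _ _).trans (B.2 ⟨T, ?_, hs, rfl⟩))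
            intro q hq
            have h := bd q hq
            have h1 : q.1 ≠ l + 1 := fun h => hrow ⟨q.2, h ▸ hq⟩
            simp only [mem_product, mem_Icc]
            omega

/-- The dynamic programming recursion computes the minimum weight of a staircase set. -/
theorem DPrec.isLeast {n : ℕ} {d g : ℕ → ℕ → ℝ} (hg : DPrec n d g) (hn : 1 ≤ n) :
    IsLeast {v : ℝ | ∃ T ⊆ Icc 1 n ×ˢ Icc 1 n, Staircase T ∧ v = ∑ q ∈ T, d q.1 q.2} (g n n) := by
  obtain ⟨h11, h1k, hl1, hlk⟩ := hg
  have row : ∀ k, k < n → g 1 (k + 1) ≤ 0 := by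
    intro k
    induction k with
    | zero => exact fun _ => h11 ▸ min_le_left _ _
    | succ k ih =>
      intro hk
      rw [h1k (k + 2) (by omega) (by omega)]
      exact (min_le_right _ _).trans (ih (by omega))
  have col : ∀ l, l < n → g (l + 1) 1 ≤ 0 := by
    intro l
    induction l with
    | zero => exact fun _ => h11 ▸ min_le_left _ _
    | succ l ih =>
      intro hl
      rw [hl1 (l + 2) (by omega) (by omega)]
      exact (min_le_right _ _).trans (ih (by omega))
  have key := isLeast_staircase_of_rec n d (fun l k => if l = 0 ∨ k = 0 then 0 else g l k)
    (by simp) (by simp) ?_ n n le_rfl le_rfl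
  · simpa [show n ≠ 0 by omega] using key
  · rintro (_ | l) (_ | k) hl hk
    · simp [h11, min_comm]
    · have h := h1k (k + 2) (by omega) (by omega)
      have h0 := row k (by omega)
      simp only [show k + 2 - 1 = k + 1 by omega] at h
      simp [h, min_assoc, h0]
    · have h := hl1 (l + 2) (by omega) (by omega)
      have h0 := col l (by omega)
      simp only [show l + 2 - 1 = l + 1 by omega] at h
      simp [h, min_assoc, h0]
    · have h := hlk (l + 2) (k + 2) (by omega) (by omega) (by omega) (by omega)
      simp only [show l + 2 - 1 = l + 1 by omega, show k + 2 - 1 = k + 1 by omega] at h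
      simp [h]

/-- The reduced cost of a column is the sum of its coefficients `d_{ij}^k` plus `γ_j + δ`. -/
theorem redCost_eq_sum_dCoef (n : ℕ) (c : Fin n → Fin n → ℝ) (lam : Fin n → ℝ)
    (r : Fin n × Fin n → Fin (n * n)) (α β γ : Fin n → ℝ) (δ : ℝ) (ε : ℕ → ℝ)
    (hε1 : ε 1 = 0) (hεtop : ε (n + 1) = 0) (S : Finset (Fin n × Fin n)) (j : Fin n) :
    redCost n c lam r α β γ δ ε S j =
      (∑ q ∈ S, dCoef n c lam r α β ε q.1 j q.2) + δ + γ j := by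
  have own : ∀ m : Fin n, ∑ k ∈ univ.filter (fun k : Fin n => 1 ≤ k.val),
      (if m = k then ε (k.val + 1) else 0) = ε (m.val + 1) := by
    intro m
    rw [sum_ite_eq]
    by_cases hm : 1 ≤ m.val
    · simp [hm]
    · simp [show m.val = 0 by omega, hε1]
  have next : ∀ m : Fin n, ∑ k ∈ univ.filter (fun k : Fin n => 1 ≤ k.val),
      (if m = fpred k then ε (k.val + 1) else 0) = ε (m.val + 2) := by
    intro m
    have hm := m.isLt
    by_cases h : m.val + 1 < n
    · rw [sum_eq_single_of_mem (⟨m.val + 1, h⟩ : Fin n) (by simp)]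
      · simp [fpred]
      · intro k hk hne
        rw [if_neg]
        intro he
        apply hne
        have h1 : m.val = k.val - 1 := congrArg Fin.val he
        have h2 : 1 ≤ k.val := by simpa using hk
        apply Fin.ext
        simp only
        omega
    · rw [show m.val + 2 = n + 1 by omega, hεtop]
      refine sum_eq_zero fun k hk => if_neg fun he => ?_
      have h1 : m.val = k.val - 1 := congrArg Fin.val he
      have h2 : 1 ≤ k.val := by simpa using hk
      have := k.isLt
      omega
  have swap : ∀ (P : Fin n → Fin n → Prop) [∀ a b, Decidable (P a b)]
      (R : Fin n → Fin n × Fin n → Prop) [∀ a b, Decidable (R a b)],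
      ∑ k ∈ univ.filter (fun k : Fin n => 1 ≤ k.val), ∑ i' : Fin n, ∑ j' : Fin n,
        ∑ q ∈ S.filter (fun q : Fin n × Fin n => P q.2 k ∧ R q.1 (i', j')), ε (k.val + 1) =
      ∑ q ∈ S, ((univ.filter (fun x : Fin n × Fin n => R q.1 x)).card : ℝ) *
        ∑ k ∈ univ.filter (fun k : Fin n => 1 ≤ k.val), (if P q.2 k then ε (k.val + 1) else 0) := by
    intro P _ R _
    simp_rw [mul_sum]
    rw [sum_comm (s := S)]
    refine sum_congr rfl fun k _ => ?_
    rw [← Fintype.sum_prod_type' (fun i' j' => ∑ q ∈ S.filter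
      (fun q : Fin n × Fin n => P q.2 k ∧ R q.1 (i', j')), ε (k.val + 1))]
    simp_rw [sum_filter]
    rw [sum_comm]
    refine sum_congr rfl fun q _ => ?_
    by_cases hP : P q.2 k
    · simp [hP, ← sum_filter]
    · simp [hP]
  unfold redCost colCost dCoef
  simp_rw [sum_add_distrib]
  rw [swap (fun m k => m = k) (fun i x => r (i, j) ≤ r x),
    swap (fun m k => m = fpred k) (fun i x => r x ≤ r (i, j))]
  simp_rw [own, next, sum_sub_distrib, sum_add_distrib]
  ring

/-- For a fixed facility `j`, running the dynamic programming recursion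
on the matrix `d(l,k) = d_{i_l j}^k` (rows sorted by the ranks `r(·, j)`) yields in
`g n n + δ + γ_j` the minimum reduced cost over all (possibly empty) feasible sets of
couples whose positions are sorted consistently with the ranks. -/
theorem statement14 (n p : ℕ) (hn : 1 ≤ n) (hp1 : 1 ≤ p) (hpn : p ≤ n)
    (c : Fin n → Fin n → ℝ) (lam : Fin n → ℝ) (hlam : ∀ k : Fin n, 0 ≤ lam k)
    (r : Fin n × Fin n → Fin (n * n)) (hr : Function.Bijective r)
    (hrc : ∀ a b : Fin n × Fin n, r a < r b → c a.1 a.2 ≤ c b.1 b.2)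
    (α β γ : Fin n → ℝ) (hγ : ∀ j : Fin n, 0 ≤ γ j) (δ : ℝ) (hδ : 0 ≤ δ)
    (ε : ℕ → ℝ) (hε : ∀ m : ℕ, 2 ≤ m → m ≤ n → 0 ≤ ε m)
    (hε1 : ε 1 = 0) (hεtop : ε (n + 1) = 0)
    (j : Fin n) (σ : Fin n → Fin n) (hσb : Function.Bijective σ)
    (hσ : ∀ l l' : Fin n, l < l' → r (σ l, j) < r (σ l', j))
    (d g : ℕ → ℕ → ℝ)
    (hd : ∀ l k : Fin n, d (l.val + 1) (k.val + 1) = dCoef n c lam r α β ε (σ l) j k)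
    (hg : DPrec n d g) :
    IsLeast {v : ℝ | ∃ S : Finset (Fin n × Fin n),
      (∀ a ∈ S, ∀ b ∈ S, a.1 = b.1 → a = b) ∧
      (∀ a ∈ S, ∀ b ∈ S, a.2 = b.2 → a = b) ∧
      (∀ a ∈ S, ∀ b ∈ S, a.2 < b.2 → r (a.1, j) < r (b.1, j)) ∧
      v = redCost n c lam r α β γ δ ε S j} (g n n + δ + γ j) := by
  let e : Fin n ≃ Fin n := Equiv.ofBijective σ hσb
  have hmono : StrictMono fun l => r (e l, j) := fun l l' h => hσ l l' h
  have hlt : ∀ i i' : Fin n, e.symm i < e.symm i' ↔ r (i, j) < r (i', j) := fun i i' => by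
    simpa using (hmono.lt_iff_lt (a := e.symm i) (b := e.symm i')).symm
  let φ : Fin n × Fin n ↪ ℕ × ℕ :=
    ⟨fun q => ((e.symm q.1).val + 1, q.2.val + 1), fun a b h => by
      simp only [Prod.mk.injEq, Nat.add_right_cancel_iff, Fin.val_inj,
        EmbeddingLike.apply_eq_iff_eq] at h
      exact Prod.ext h.1 h.2⟩
  have hφ : ∀ q, φ q = ((e.symm q.1).val + 1, q.2.val + 1) := fun _ => rfl
  have hcost : ∀ S : Finset (Fin n × Fin n), redCost n c lam r α β γ δ ε S j =
      (∑ q ∈ S.map φ, d q.1 q.2) + δ + γ j := fun S => by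
    rw [redCost_eq_sum_dCoef n c lam r α β γ δ ε hε1 hεtop, sum_map]
    congr 2
    refine sum_congr rfl fun q _ => ?_
    rw [hφ, hd]
    exact congrArg (fun i => dCoef n c lam r α β ε i j q.2) (e.apply_symm_apply q.1).symm
  have hstair : ∀ S : Finset (Fin n × Fin n), Staircase (S.map φ) ↔
      (∀ a ∈ S, ∀ b ∈ S, a.1 = b.1 → a = b) ∧ (∀ a ∈ S, ∀ b ∈ S, a.2 = b.2 → a = b) ∧
      (∀ a ∈ S, ∀ b ∈ S, a.2 < b.2 → r (a.1, j) < r (b.1, j)) := by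
    intro S
    have hS : Staircase (S.map φ) ↔
        ∀ a ∈ S, ∀ b ∈ S, a ≠ b → (r (a.1, j) < r (b.1, j) ↔ a.2 < b.2) := by
      simp only [Staircase, forall_mem_map, ne_eq, EmbeddingLike.apply_eq_iff_eq]
      simp only [hφ, add_lt_add_iff_right, Fin.val_fin_lt, hlt]
    rw [hS]
    constructor
    · intro h
      refine ⟨fun a ha b hb hab => ?_, fun a ha b hb hab => ?_, fun a ha b hb hab => ?_⟩
      · by_contra hne
        have h1 := h a ha b hb hne
        have h2 := h b hb a ha (Ne.symm hne)
        simp only [hab, lt_self_iff_false, false_iff, not_lt] at h1 h2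
        exact hne (Prod.ext hab (le_antisymm h2 h1))
      · by_contra hne
        have h1 := h a ha b hb hne
        have h2 := h b hb a ha (Ne.symm hne)
        simp only [hab, lt_self_iff_false, iff_false, not_lt] at h1 h2
        have := hr.1 (le_antisymm h2 h1)
        exact hne (Prod.ext (Prod.ext_iff.1 this).1 hab)
      · exact (h a ha b hb (by rintro rfl; exact lt_irrefl _ hab)).2 hab
    · rintro ⟨-, h2, h3⟩ a ha b hb hne
      refine ⟨fun h => ?_, h3 a ha b hb⟩
      rcases lt_trichotomy a.2 b.2 with h' | h' | h'
      · exact h'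
      · exact absurd (h2 a ha b hb h') hne
      · exact absurd (h3 b hb a ha h') h.asymm
  obtain ⟨⟨T, hT, hTs, hTv⟩, hmin⟩ := hg.isLeast hn
  constructor
  · have hmap : (univ.filter (fun q => φ q ∈ T)).map φ = T := by
      ext x
      simp only [mem_map, mem_filter, mem_univ, true_and]
      refine ⟨fun ⟨q, hq, hx⟩ => hx ▸ hq, fun hx => ?_⟩
      have hb := hT hx
      simp only [mem_product, mem_Icc] at hb
      have hq : φ (e ⟨x.1 - 1, by omega⟩, ⟨x.2 - 1, by omega⟩) = x := by
        rw [hφ, Equiv.symm_apply_apply]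
        exact Prod.ext (Nat.sub_add_cancel hb.1.1) (Nat.sub_add_cancel hb.2.1)
      exact ⟨_, hq.symm ▸ hx, hq⟩
    obtain ⟨h1, h2, h3⟩ := (hstair _).1 (hmap.symm ▸ hTs)
    exact ⟨_, h1, h2, h3, by rw [hcost, hmap, hTv]⟩
  · rintro v ⟨S, h1, h2, h3, rfl⟩
    rw [hcost]
    have := hmin ⟨S.map φ, ?_, (hstair S).2 ⟨h1, h2, h3⟩, rfl⟩
    · linarith
    · intro x hx
      obtain ⟨q, -, rfl⟩ := mem_map.1 hx
      simp only [hφ, mem_product, mem_Icc]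
      omega

end DOMP
end

section
/- Let z_D(π) := Σ_{i∈I} α_i + Σ_{k=1}^n β_k − Σ_{j∈I} γ_j − p·δ − Σ_{k=2}^n n²·ε_k. Then for every y feasible for the LP relaxation of MP, the following two Lagrangian lower bounds hold: Σ_j Σ_S c_S^j y_S^j ≥ z_D(π) + p · min{0, min over all columns (S,j) of c̄_S^j}, and Σ_j Σ_S c_S^j y_S^j ≥ z_D(π) + Σ_{j∈I} min{0, min over all sets S with (S,j) a column of c̄_S^j}. -/
open Finset

namespace DOMP

/-- The `y`-weighted sum of `f S j` over all columns `(S, j)`. -/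
noncomputable def colSum (n : ℕ) (y f : Finset (Fin n × Fin n) → Fin n → ℝ) : ℝ :=
  ∑ j : Fin n, ∑ S ∈ univ.filter (IsCol n), f S j * y S j

theorem colSum_congr {n : ℕ} {y f g : Finset (Fin n × Fin n) → Fin n → ℝ}
    (h : ∀ S j, IsCol n S → f S j = g S j) : colSum n y f = colSum n y g :=
  sum_congr rfl fun j _ => sum_congr rfl fun S hS => by rw [h S j (mem_filter.1 hS).2]

theorem colSum_add {n : ℕ} (y f g : Finset (Fin n × Fin n) → Fin n → ℝ) :
    colSum n y (fun S j => f S j + g S j) = colSum n y f + colSum n y g := by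
  simp only [colSum, add_mul, sum_add_distrib]

theorem colSum_sub {n : ℕ} (y f g : Finset (Fin n × Fin n) → Fin n → ℝ) :
    colSum n y (fun S j => f S j - g S j) = colSum n y f - colSum n y g := by
  simp only [colSum, sub_mul, sum_sub_distrib]

theorem colSum_sum {n : ℕ} {ι : Type*} (T : Finset ι)
    (y : Finset (Fin n × Fin n) → Fin n → ℝ) (f : ι → Finset (Fin n × Fin n) → Fin n → ℝ) :
    colSum n y (fun S j => ∑ t ∈ T, f t S j) = ∑ t ∈ T, colSum n y (f t) := by
  simp only [colSum, sum_mul]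
  exact (sum_congr rfl fun j _ => sum_comm).trans sum_comm

theorem colSum_ite {n : ℕ} (y : Finset (Fin n × Fin n) → Fin n → ℝ) (e : ℝ)
    (Q : Finset (Fin n × Fin n) → Fin n → Prop) [∀ S j, Decidable (Q S j)] :
    colSum n y (fun S j => if Q S j then e else 0)
      = e * ∑ j : Fin n, ∑ S ∈ univ.filter (fun S => IsCol n S ∧ Q S j), y S j := by
  simp only [colSum, mul_sum, ← filter_filter, sum_filter, ite_mul, zero_mul,
    mul_ite, mul_zero]

/-- A constant summed over a set with at most one element. -/
theorem sum_const_of_subsingleton {ι : Type*} {T : Finset ι} {e : ℝ} {P : Prop} [Decidable P]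
    (h : ∀ a ∈ T, ∀ b ∈ T, a = b) (hP : T.Nonempty ↔ P) :
    ∑ _q ∈ T, e = if P then e else 0 := by
  split_ifs with hp
  · obtain ⟨a, ha⟩ := hP.2 hp
    rw [eq_singleton_iff_unique_mem.2 ⟨ha, fun b hb => h b hb a ha⟩, sum_singleton]
  · rw [not_nonempty_iff_eq_empty.1 (fun h' => hp (hP.1 h')), sum_empty]

theorem IsCol.sum_fst {n : ℕ} {S : Finset (Fin n × Fin n)} (hS : IsCol n S) (a : Fin n → ℝ) :
    ∑ q ∈ S, a q.1 = ∑ i : Fin n, if ∃ k, (i, k) ∈ S then a i else 0 := by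
  rw [← sum_fiberwise S Prod.fst]
  refine sum_congr rfl fun i _ => ?_
  rw [sum_congr rfl fun q hq => by rw [(mem_filter.1 hq).2]]
  refine sum_const_of_subsingleton (fun u hu v hv => ?_) ?_
  · rw [mem_filter] at hu hv
    exact hS.2.1 u hu.1 v hv.1 (hu.2.trans hv.2.symm)
  · simp [Finset.Nonempty]

theorem IsCol.sum_snd {n : ℕ} {S : Finset (Fin n × Fin n)} (hS : IsCol n S) (b : Fin n → ℝ) :
    ∑ q ∈ S, b q.2 = ∑ k : Fin n, if ∃ i, (i, k) ∈ S then b k else 0 := by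
  rw [← sum_fiberwise S Prod.snd]
  refine sum_congr rfl fun k _ => ?_
  rw [sum_congr rfl fun q hq => by rw [(mem_filter.1 hq).2]]
  refine sum_const_of_subsingleton (fun u hu v hv => ?_) ?_
  · rw [mem_filter] at hu hv
    exact hS.2.2 u hu.1 v hv.1 (hu.2.trans hv.2.symm)
  · simp [Finset.Nonempty]

theorem IsCol.sum_snd_eq {n : ℕ} {S : Finset (Fin n × Fin n)} (hS : IsCol n S) (k : Fin n)
    (P : Fin n → Prop) [DecidablePred P] (e : ℝ) :
    ∑ _q ∈ S.filter (fun q : Fin n × Fin n => q.2 = k ∧ P q.1), e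
      = if ∃ i, (i, k) ∈ S ∧ P i then e else 0 := by
  refine sum_const_of_subsingleton (fun u hu v hv => ?_) ?_
  · rw [mem_filter] at hu hv
    exact hS.2.2 u hu.1 v hv.1 (hu.2.1.trans hv.2.1.symm)
  · simp only [Finset.Nonempty, mem_filter]
    constructor
    · rintro ⟨⟨i, k'⟩, h, rfl, hP⟩
      exact ⟨i, h, hP⟩
    · rintro ⟨i, h, hP⟩
      exact ⟨(i, k), h, rfl, hP⟩

theorem sum_Icc_two_eq (n : ℕ) (f : ℕ → ℝ) :
    ∑ m ∈ Finset.Icc 2 n, f m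
      = ∑ k ∈ univ.filter (fun k : Fin n => 1 ≤ k.val), f (k.val + 1) := by
  symm
  refine sum_bij (fun k _ => k.val + 1) ?_ ?_ ?_ (fun _ _ => rfl)
  · intro k hk
    have := (mem_filter.1 hk).2
    have := k.isLt
    exact mem_Icc.2 ⟨by omega, by omega⟩
  · intro a _ b _ h
    exact Fin.ext (by omega)
  · intro m hm
    rw [mem_Icc] at hm
    exact ⟨⟨m - 1, by omega⟩, by simp; omega, by simp; omega⟩

/-- Weak duality with slack: the objective exceeds the dual objective by at least the
`y`-weighted sum of the reduced costs. -/
theorem zD_add_colSum_redCost_le {n p : ℕ}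
    (c : Fin n → Fin n → ℝ) (lam : Fin n → ℝ) (r : Fin n × Fin n → Fin (n * n))
    (α β γ : Fin n → ℝ) (hγ : ∀ j : Fin n, 0 ≤ γ j) (δ : ℝ) (hδ : 0 ≤ δ)
    (ε : ℕ → ℝ) (hε : ∀ m : ℕ, 2 ≤ m → m ≤ n → 0 ≤ ε m)
    (y : Finset (Fin n × Fin n) → Fin n → ℝ) (hy : MPfeas n p r y) :
    zD n p α β γ δ ε + colSum n y (redCost n c lam r α β γ δ ε) ≤ objMP n c lam y := by
  obtain ⟨-, h1, h2, h3, h4, h5⟩ := hy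
  have hα : colSum n y (fun S _ => ∑ q ∈ S, α q.1) = ∑ i, α i := by
    rw [colSum_congr fun S _ hS => hS.sum_fst α, colSum_sum]
    refine sum_congr rfl fun i _ => ?_
    rw [colSum_ite, h1 i, mul_one]
  have hβ : colSum n y (fun S _ => ∑ q ∈ S, β q.2) = ∑ k, β k := by
    rw [colSum_congr fun S _ hS => hS.sum_snd β, colSum_sum]
    refine sum_congr rfl fun k _ => ?_
    rw [colSum_ite, h2 k, mul_one]
  have hγ' : colSum n y (fun _ j => γ j) ≤ ∑ j, γ j := by
    refine sum_le_sum fun j _ => ?_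
    rw [← mul_sum]
    exact mul_le_of_le_one_right (hγ j) (h3 j)
  have hδ' : colSum n y (fun _ _ => δ) ≤ p * δ := by
    simp only [colSum, ← mul_sum]
    rw [mul_comm (p : ℝ)]
    exact mul_le_mul_of_nonneg_left h4 hδ
  have hε' : colSum n y (fun S j =>
      ∑ k ∈ univ.filter (fun k : Fin n => 1 ≤ k.val), ∑ i' : Fin n, ∑ j' : Fin n,
        ((∑ q ∈ S.filter (fun q : Fin n × Fin n => q.2 = k ∧ r (q.1, j) ≤ r (i', j')),
            ε (k.val + 1)) +
         (∑ q ∈ S.filter (fun q : Fin n × Fin n => q.2 = fpred k ∧ r (i', j') ≤ r (q.1, j)),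
            ε (k.val + 1)))) ≤ ∑ m ∈ Finset.Icc 2 n, (n : ℝ) ^ 2 * ε m := by
    rw [sum_Icc_two_eq, colSum_sum]
    refine sum_le_sum fun k hk => ?_
    have hk1 := (mem_filter.1 hk).2
    have hk2 := k.isLt
    rw [mul_comm ((n : ℝ) ^ 2)]
    refine le_trans (le_of_eq ?_)
      (mul_le_mul_of_nonneg_left (h5 k hk1) (hε (k.val + 1) (by omega) (by omega)))
    simp only [colSum_sum, colSum_add, mul_sum, mul_add]
    refine sum_congr rfl fun i' _ => sum_congr rfl fun j' _ => congrArg₂ (· + ·) ?_ ?_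
    · rw [colSum_congr fun S j hS => hS.sum_snd_eq k (fun i => r (i, j) ≤ r (i', j')) _,
        colSum_ite]
      simp only [mul_sum]
    · rw [colSum_congr fun S j hS => hS.sum_snd_eq (fpred k) (fun i => r (i', j') ≤ r (i, j)) _,
        colSum_ite]
      simp only [mul_sum]
  have hobj : colSum n y (colCost n c lam) = objMP n c lam y := rfl
  have hred : colSum n y (redCost n c lam r α β γ δ ε) = _ :=
    (colSum_sub y _ _).trans <| congrArg (· - _) <| (colSum_sub y _ _).trans <|
      congrArg (· - _) <| (colSum_add y _ _).trans <| congrArg (· + _) <|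
      (colSum_add y _ _).trans <| congrArg (· + _) (colSum_add y _ _)
  rw [hα, hβ, hobj] at hred
  rw [hred, zD]
  linarith

/-- Lagrangian lower bounds: for every `y` feasible for the LP
relaxation of MP, the MP objective is at least `z_D(π) + p·min{0, min_{S,j} c̄_S^j}` and at
least `z_D(π) + ∑_j min{0, min_S c̄_S^j}`. -/
theorem statement16 (n p : ℕ) (hn : 1 ≤ n) (hp1 : 1 ≤ p) (hpn : p ≤ n)
    (c : Fin n → Fin n → ℝ) (lam : Fin n → ℝ) (hlam : ∀ k : Fin n, 0 ≤ lam k)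
    (r : Fin n × Fin n → Fin (n * n)) (hr : Function.Bijective r)
    (α β γ : Fin n → ℝ) (hγ : ∀ j : Fin n, 0 ≤ γ j) (δ : ℝ) (hδ : 0 ≤ δ)
    (ε : ℕ → ℝ) (hε : ∀ m : ℕ, 2 ≤ m → m ≤ n → 0 ≤ ε m)
    (hε1 : ε 1 = 0) (hεtop : ε (n + 1) = 0)
    (y : Finset (Fin n × Fin n) → Fin n → ℝ) (hy : MPfeas n p r y) :
    objMP n c lam y ≥ zD n p α β γ δ ε
        + (p : ℝ) * min 0 (sInf {v : ℝ | ∃ (S : Finset (Fin n × Fin n)) (j : Fin n),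
            IsCol n S ∧ v = redCost n c lam r α β γ δ ε S j}) ∧
    objMP n c lam y ≥ zD n p α β γ δ ε
        + ∑ j : Fin n, min 0 (sInf {v : ℝ | ∃ S : Finset (Fin n × Fin n),
            IsCol n S ∧ v = redCost n c lam r α β γ δ ε S j}) := by
  have hdual := zD_add_colSum_redCost_le c lam r α β γ hγ δ hδ ε hε y hy
  obtain ⟨hy0, -, -, h3, h4, -⟩ := hy
  have hY : ∀ j : Fin n, ∀ S ∈ univ.filter (IsCol n), 0 ≤ y S j :=
    fun j S hS => (hy0 S j (mem_filter.1 hS).2).1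
  constructor
  · set m := sInf {v : ℝ | ∃ (S : Finset (Fin n × Fin n)) (j : Fin n),
      IsCol n S ∧ v = redCost n c lam r α β γ δ ε S j}
    have hbdd : BddBelow {v : ℝ | ∃ (S : Finset (Fin n × Fin n)) (j : Fin n),
        IsCol n S ∧ v = redCost n c lam r α β γ δ ε S j} := by
      refine ((Set.finite_range fun x : Finset (Fin n × Fin n) × Fin n =>
        redCost n c lam r α β γ δ ε x.1 x.2).subset ?_).bddBelow
      rintro _ ⟨S, j, -, rfl⟩
      exact ⟨(S, j), rfl⟩
    have hle : (p : ℝ) * min 0 m ≤ colSum n y (redCost n c lam r α β γ δ ε) := by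
      calc (p : ℝ) * min 0 m
          ≤ (∑ j : Fin n, ∑ S ∈ univ.filter (IsCol n), y S j) * min 0 m :=
            mul_le_mul_of_nonpos_right h4 (min_le_left _ _)
        _ = ∑ j : Fin n, ∑ S ∈ univ.filter (IsCol n), min 0 m * y S j := by
            rw [mul_comm]; simp only [mul_sum]
        _ ≤ _ := sum_le_sum fun j _ => sum_le_sum fun S hS =>
            mul_le_mul_of_nonneg_right ((min_le_right _ _).trans
              (csInf_le hbdd ⟨S, j, (mem_filter.1 hS).2, rfl⟩)) (hY j S hS)
    linarith
  · refine ge_iff_le.2 (le_trans ?_ hdual)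
    gcongr
    refine sum_le_sum fun j _ => ?_
    set m := sInf {v : ℝ | ∃ S : Finset (Fin n × Fin n),
      IsCol n S ∧ v = redCost n c lam r α β γ δ ε S j}
    have hbdd : BddBelow {v : ℝ | ∃ S : Finset (Fin n × Fin n),
        IsCol n S ∧ v = redCost n c lam r α β γ δ ε S j} := by
      refine ((Set.finite_range fun S : Finset (Fin n × Fin n) =>
        redCost n c lam r α β γ δ ε S j).subset ?_).bddBelow
      rintro _ ⟨S, -, rfl⟩
      exact ⟨S, rfl⟩
    calc min 0 m
        ≤ min 0 m * ∑ S ∈ univ.filter (IsCol n), y S j :=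
          le_mul_of_le_one_right (min_le_left _ _) (h3 j)
      _ = ∑ S ∈ univ.filter (IsCol n), min 0 m * y S j := mul_sum _ _ _
      _ ≤ _ := sum_le_sum fun S hS =>
          mul_le_mul_of_nonneg_right ((min_le_right _ _).trans
            (csInf_le hbdd ⟨S, (mem_filter.1 hS).2, rfl⟩)) (hY j S hS)

end DOMP
end
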